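/- Let (X,T) be an NDS, Z ⊂ X_0 and f a potential. Then: (1) P^B(T,f,Z) ≤ Q_low(T,f,Z) ≤ Q_up(T,f,Z); (2) P^B(T,f,Z) ≤ P_low(T,f,Z) ≤ P_up(T,f,Z); (3) P^B(T,f,Z) ≤ P^P(T,f,Z) ≤ P_up(T,f,Z). -/

import Mathlib

open Filter Set
open scoped ENNReal NNReal

noncomputable section

namespace NDS

variable {X : ℕ → Type*}

/-- The orbit maps `T_k^j : X k → X (k+j)` of a nonautonomous system. -/
def iterFrom (T : ∀ k, X k → X (k + 1)) (k : ℕ) : ∀ j, X k → X (k + j)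
  | 0 => fun x => x
  | j + 1 => fun x => T (k + j) (iterFrom T k j x)

/-- The orbit maps `T^j = T_{j-1} ∘ ⋯ ∘ T_0 : X 0 → X j`. -/
def iter (T : ∀ k, X k → X (k + 1)) : ∀ j, X 0 → X j
  | 0 => fun x => x
  | j + 1 => fun x => T j (iter T j x)

variable [∀ k, MetricSpace (X k)]

/-- The `n`-th Bowen metric on `X 0`:  `d_n^T(x,y) = max_{0 ≤ j ≤ n-1} d_j (T^j x) (T^j y)`. -/
def bowenDist (T : ∀ k, X k → X (k + 1)) (n : ℕ) (x y : X 0) : ℝ :=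
  (((Finset.range n).sup fun j => nndist (iter T j x) (iter T j y) : ℝ≥0) : ℝ)

/-- The open Bowen ball `B_n^T(x, ε)`. -/
def bowenBall (T : ∀ k, X k → X (k + 1)) (n : ℕ) (x : X 0) (ε : ℝ) : Set (X 0) :=
  {y | bowenDist T n x y < ε}

/-- The closed Bowen ball `clB_n^T(x, ε)`. -/
def bowenClosedBall (T : ∀ k, X k → X (k + 1)) (n : ℕ) (x : X 0) (ε : ℝ) : Set (X 0) :=
  {y | bowenDist T n x y ≤ ε}

/-- Birkhoff sums starting at level `k`:  `S_{k,n}^T f = Σ_{j<n} f_{k+j} ∘ T_k^j`. -/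
def birkFrom (T : ∀ k, X k → X (k + 1)) (f : ∀ k, X k → ℝ) (k n : ℕ) (x : X k) : ℝ :=
  ∑ j ∈ Finset.range n, f (k + j) (iterFrom T k j x)

/-- Birkhoff sums `S_n^T f = Σ_{j<n} f_j ∘ T^j` on `X 0`. -/
def birk (T : ∀ k, X k → X (k + 1)) (f : ∀ k, X k → ℝ) (n : ℕ) (x : X 0) : ℝ :=
  ∑ j ∈ Finset.range n, f j (iter T j x)

/-- A potential `f = {f_k}` is equicontinuous. -/
def EquicontPotential (f : ∀ k, X k → ℝ) : Prop :=
  ∀ ε : ℝ, 0 < ε → ∃ δ : ℝ, 0 < δ ∧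
    ∀ k, ∀ x y : X k, dist x y < δ → |f k x - f k y| < ε

/-- The sequence of maps `T = {T_k}` is equicontinuous. -/
def EquicontMaps (T : ∀ k, X k → X (k + 1)) : Prop :=
  ∀ ε : ℝ, 0 < ε → ∃ δ : ℝ, 0 < δ ∧
    ∀ k, ∀ x y : X k, dist x y < δ → dist (T k x) (T k y) < ε

/-- `F` is an `(n,ε)`-spanning set for `Z`. -/
def IsSpanning (T : ∀ k, X k → X (k + 1)) (n : ℕ) (ε : ℝ) (Z : Set (X 0))
    (F : Finset (X 0)) : Prop :=
  ∀ x ∈ Z, ∃ y ∈ F, bowenDist T n x y ≤ ε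

/-- `E` is an `(n,ε)`-separated set for `Z`. -/
def IsSeparated (T : ∀ k, X k → X (k + 1)) (n : ℕ) (ε : ℝ) (Z : Set (X 0))
    (E : Finset (X 0)) : Prop :=
  ↑E ⊆ Z ∧ ∀ x ∈ E, ∀ y ∈ E, x ≠ y → ε < bowenDist T n x y

/-- The partition sum `Σ_{x ∈ F} e^{S_n^T f(x)}` (valued in `ℝ≥0∞`). -/
def partSum (T : ∀ k, X k → X (k + 1)) (f : ∀ k, X k → ℝ) (n : ℕ) (F : Finset (X 0)) : ℝ≥0∞ :=
  ∑ x ∈ F, ENNReal.ofReal (Real.exp (birk T f n x))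

/-- `Q_n(T,f,Z,ε)`, infimum over `(n,ε)`-spanning sets. -/
def Qn (T : ∀ k, X k → X (k + 1)) (f : ∀ k, X k → ℝ) (Z : Set (X 0)) (n : ℕ) (ε : ℝ) : ℝ≥0∞ :=
  ⨅ (F : Finset (X 0)) (_ : IsSpanning T n ε Z F), partSum T f n F

/-- `P_n(T,f,Z,ε)`, supremum over `(n,ε)`-separated sets. -/
def Pn (T : ∀ k, X k → X (k + 1)) (f : ∀ k, X k → ℝ) (Z : Set (X 0)) (n : ℕ) (ε : ℝ) : ℝ≥0∞ :=
  ⨆ (E : Finset (X 0)) (_ : IsSeparated T n ε Z E), partSum T f n E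

/-- `liminf_n (1/n) log u n` (in `EReal`). -/
def lowRate (u : ℕ → ℝ≥0∞) : EReal :=
  Filter.atTop.liminf fun n : ℕ => (((n : ℝ)⁻¹ : ℝ) : EReal) * ENNReal.log (u n)

/-- `limsup_n (1/n) log u n` (in `EReal`). -/
def upRate (u : ℕ → ℝ≥0∞) : EReal :=
  Filter.atTop.limsup fun n : ℕ => (((n : ℝ)⁻¹ : ℝ) : EReal) * ENNReal.log (u n)

/-- Lower spanning topological pressure `Q_low(T,f,Z)`; the limit as `ε → 0` is realised as a
supremum over `ε > 0`, the quantity being monotone in `ε`. -/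
def Qlow (T : ∀ k, X k → X (k + 1)) (f : ∀ k, X k → ℝ) (Z : Set (X 0)) : EReal :=
  ⨆ (ε : ℝ) (_ : 0 < ε), lowRate fun n => Qn T f Z n ε

/-- Upper spanning topological pressure `Q_up(T,f,Z)`. -/
def Qup (T : ∀ k, X k → X (k + 1)) (f : ∀ k, X k → ℝ) (Z : Set (X 0)) : EReal :=
  ⨆ (ε : ℝ) (_ : 0 < ε), upRate fun n => Qn T f Z n ε

/-- Lower separated topological pressure `P_low(T,f,Z)`. -/
def Plow (T : ∀ k, X k → X (k + 1)) (f : ∀ k, X k → ℝ) (Z : Set (X 0)) : EReal :=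
  ⨆ (ε : ℝ) (_ : 0 < ε), lowRate fun n => Pn T f Z n ε

/-- Upper separated topological pressure `P_up(T,f,Z)`. -/
def Pup (T : ∀ k, X k → X (k + 1)) (f : ∀ k, X k → ℝ) (Z : Set (X 0)) : EReal :=
  ⨆ (ε : ℝ) (_ : 0 < ε), upRate fun n => Pn T f Z n ε

/-- The critical value `inf {s : M s = 0}` of a "measure profile" `M`, as an extended real. -/
def crit (M : ℝ → ℝ≥0∞) : EReal :=
  sInf (Real.toEReal '' {s : ℝ | M s = 0})

/-- The critical value `sup {s : M s = ∞}` of a "measure profile" `M`, as an extended real. -/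
def critSup (M : ℝ → ℝ≥0∞) : EReal :=
  sSup (Real.toEReal '' {s : ℝ | M s = ⊤})

/-- A countable family of Bowen balls (recorded by their (center, order) data) which is an
`(N,ε)`-cover of `Z`. -/
def IsBowenCover (T : ∀ k, X k → X (k + 1)) (N : ℕ) (ε : ℝ) (Z : Set (X 0))
    (C : Set (X 0 × ℕ)) : Prop :=
  C.Countable ∧ (∀ p ∈ C, N ≤ p.2) ∧ Z ⊆ ⋃ p ∈ C, bowenBall T p.2 p.1 ε

/-- A countable disjoint family of closed Bowen balls with centers in `Z` and orders `≥ N`: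
an `(N,ε)`-packing of `Z`. -/
def IsBowenPacking (T : ∀ k, X k → X (k + 1)) (N : ℕ) (ε : ℝ) (Z : Set (X 0))
    (P : Set (X 0 × ℕ)) : Prop :=
  P.Countable ∧ (∀ p ∈ P, p.1 ∈ Z ∧ N ≤ p.2) ∧
    ∀ p ∈ P, ∀ q ∈ P, p ≠ q →
      Disjoint (bowenClosedBall T p.2 p.1 ε) (bowenClosedBall T q.2 q.1 ε)

/-- `Σ_i exp (-n_i s + S_{n_i}^T f (x_i))` over a family of (center, order) pairs. -/
def ballSum (T : ∀ k, X k → X (k + 1)) (f : ∀ k, X k → ℝ) (s : ℝ) (C : Set (X 0 × ℕ)) : ℝ≥0∞ :=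
  ∑' p : C, ENNReal.ofReal (Real.exp (-(p.1.2 : ℝ) * s + birk T f p.1.2 p.1.1))

/-- The Hausdorff-type pre-measure `M^s_{N,ε}(T,f,Z)`. -/
def bowenPreMeas (T : ∀ k, X k → X (k + 1)) (f : ∀ k, X k → ℝ) (Z : Set (X 0))
    (s : ℝ) (N : ℕ) (ε : ℝ) : ℝ≥0∞ :=
  ⨅ (C : Set (X 0 × ℕ)) (_ : IsBowenCover T N ε Z C), ballSum T f s C

/-- `M^s_ε(T,f,Z) = lim_{N → ∞} M^s_{N,ε}(T,f,Z)` (an increasing limit, i.e. a supremum). -/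
def bowenMeas (T : ∀ k, X k → X (k + 1)) (f : ∀ k, X k → ℝ) (Z : Set (X 0))
    (s : ℝ) (ε : ℝ) : ℝ≥0∞ :=
  ⨆ N : ℕ, bowenPreMeas T f Z s N ε

/-- `P^B(T,f,Z,ε)`: the critical value of `s ↦ M^s_ε(T,f,Z)`. -/
def PBe (T : ∀ k, X k → X (k + 1)) (f : ∀ k, X k → ℝ) (Z : Set (X 0)) (ε : ℝ) : EReal :=
  crit fun s => bowenMeas T f Z s ε

/-- The Bowen (Pesin–Pitskel') topological pressure `P^B(T,f,Z)`; the limit as `ε → 0` is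
realised as a supremum over `ε > 0` by monotonicity. -/
def PB (T : ∀ k, X k → X (k + 1)) (f : ∀ k, X k → ℝ) (Z : Set (X 0)) : EReal :=
  ⨆ (ε : ℝ) (_ : 0 < ε), PBe T f Z ε

/-- The packing pre-measure `𝒫^s_{N,ε}(T,f,Z)`. -/
def packPre (T : ∀ k, X k → X (k + 1)) (f : ∀ k, X k → ℝ) (Z : Set (X 0))
    (s : ℝ) (N : ℕ) (ε : ℝ) : ℝ≥0∞ :=
  ⨆ (P : Set (X 0 × ℕ)) (_ : IsBowenPacking T N ε Z P), ballSum T f s P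

/-- The packing content `𝒫^s_{∞,ε}(T,f,Z) = lim_{N→∞} 𝒫^s_{N,ε}` (a decreasing limit, i.e. an
infimum). -/
def packContent (T : ∀ k, X k → X (k + 1)) (f : ∀ k, X k → ℝ) (Z : Set (X 0))
    (s : ℝ) (ε : ℝ) : ℝ≥0∞ :=
  ⨅ N : ℕ, packPre T f Z s N ε

/-- The packing measure `𝒫^s_ε(T,f,Z)`, obtained from the content by countable decompositions. -/
def packMeas (T : ∀ k, X k → X (k + 1)) (f : ∀ k, X k → ℝ) (Z : Set (X 0))
    (s : ℝ) (ε : ℝ) : ℝ≥0∞ :=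
  ⨅ (D : ℕ → Set (X 0)) (_ : Z ⊆ ⋃ i, D i), ∑' i, packContent T f (D i) s ε

/-- `P^P(T,f,Z,ε)`: the critical value of `s ↦ 𝒫^s_ε(T,f,Z)`. -/
def PPe (T : ∀ k, X k → X (k + 1)) (f : ∀ k, X k → ℝ) (Z : Set (X 0)) (ε : ℝ) : EReal :=
  crit fun s => packMeas T f Z s ε

/-- The packing topological pressure `P^P(T,f,Z)`. -/
def PP (T : ∀ k, X k → X (k + 1)) (f : ∀ k, X k → ℝ) (Z : Set (X 0)) : EReal :=
  ⨆ (ε : ℝ) (_ : 0 < ε), PPe T f Z ε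

end NDS

namespace NDS

section helpers

theorem rate_lt {n : ℕ} (hn : 0 < n) {u : ℝ≥0∞} {s : ℝ}
    (h : (((n : ℝ)⁻¹ : ℝ) : EReal) * ENNReal.log u < (s : EReal)) :
    u < ENNReal.ofReal (Real.exp (n * s)) := by
  rw [← ENNReal.log_lt_log_iff, ENNReal.log_ofReal_of_pos (Real.exp_pos _), Real.log_exp]
  by_contra hc
  push Not at hc
  have hn' : (0 : ℝ) < n := by exact_mod_cast hn
  have h0 : (0 : EReal) ≤ (((n : ℝ)⁻¹ : ℝ) : EReal) := by
    exact_mod_cast (inv_pos.mpr hn').le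
  have h1 := mul_le_mul_of_nonneg_left hc h0
  rw [← EReal.coe_mul, inv_mul_cancel_left₀ hn'.ne'] at h1
  exact absurd h (not_lt.mpr h1)

theorem lowRate_mono {u v : ℕ → ℝ≥0∞} (h : ∀ n, u n ≤ v n) : lowRate u ≤ lowRate v := by
  unfold lowRate
  refine Filter.liminf_le_liminf (Filter.Eventually.of_forall fun n => ?_)
  refine mul_le_mul_of_nonneg_left (ENNReal.log_monotone (h n)) ?_
  exact_mod_cast (inv_nonneg.mpr (Nat.cast_nonneg n))

theorem lowRate_le_upRate (u : ℕ → ℝ≥0∞) : lowRate u ≤ upRate u :=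
  Filter.liminf_le_limsup

theorem crit_le {M : ℝ → ℝ≥0∞} {r : EReal}
    (h : ∀ s s' : ℝ, r < (s' : EReal) → s' < s → M s = 0) : crit M ≤ r := by
  refine EReal.le_of_forall_lt_iff_le.mp fun s hs => ?_
  obtain ⟨s', h1, h2⟩ := EReal.lt_iff_exists_real_btwn.mp hs
  exact sInf_le ⟨s, h s s' h1 (by exact_mod_cast h2), rfl⟩

theorem crit_mono {M M' : ℝ → ℝ≥0∞} (h : ∀ s, M s ≤ M' s) : crit M ≤ crit M' := by
  refine sInf_le_sInf (Set.image_mono fun s hs => ?_)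
  exact le_antisymm ((h s).trans (le_of_eq hs)) bot_le

theorem exp_pow (s s' : ℝ) (n : ℕ) :
    ENNReal.ofReal (Real.exp (-(n : ℝ) * s)) * ENNReal.ofReal (Real.exp (n * s')) =
      (ENNReal.ofReal (Real.exp (s' - s))) ^ n := by
  rw [← ENNReal.ofReal_mul (Real.exp_pos _).le, ← Real.exp_add,
    ← ENNReal.ofReal_pow (Real.exp_pos _).le, ← Real.exp_nat_mul]
  congr 2; ring

theorem r_lt_one {s s' : ℝ} (h : s' < s) : ENNReal.ofReal (Real.exp (s' - s)) < 1 := by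
  rw [ENNReal.ofReal_lt_one, Real.exp_lt_one_iff]; linarith

variable {X : ℕ → Type*} [∀ k, MetricSpace (X k)] (T : ∀ k, X k → X (k + 1))

theorem bowenDist_comm (n : ℕ) (x y : X 0) : bowenDist T n x y = bowenDist T n y x := by
  unfold bowenDist; simp only [nndist_comm]

theorem bowenDist_self (n : ℕ) (x : X 0) : bowenDist T n x x = 0 := by
  unfold bowenDist; simp

theorem bowenDist_triangle (n : ℕ) (x y z : X 0) :
    bowenDist T n x z ≤ bowenDist T n x y + bowenDist T n y z := by
  unfold bowenDist
  rw [← NNReal.coe_add, NNReal.coe_le_coe]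
  refine Finset.sup_le fun j hj => (nndist_triangle _ (iter T j y) _).trans ?_
  exact add_le_add
    (Finset.le_sup (f := fun j => nndist (iter T j x) (iter T j y)) hj)
    (Finset.le_sup (f := fun j => nndist (iter T j y) (iter T j z)) hj)

variable {T} in
theorem iter_continuous (hT : ∀ k, Continuous (T k)) (j : ℕ) : Continuous (iter T j) := by
  induction j with
  | zero => exact continuous_id
  | succ j ih => exact (hT j).comp ih

variable {T} in
theorem isOpen_bowenBall (hT : ∀ k, Continuous (T k)) (n : ℕ) (x : X 0) (ε : ℝ) :
    IsOpen (bowenBall T n x ε) := by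
  have : Continuous fun y => bowenDist T n x y := by
    unfold bowenDist
    refine NNReal.continuous_coe.comp ?_
    refine Continuous.finset_sup_apply fun j _ => ?_
    exact continuous_const.nndist (iter_continuous hT j)
  exact isOpen_lt this continuous_const

variable {T} in
theorem exists_sep_span [CompactSpace (X 0)] (hT : ∀ k, Continuous (T k)) (n : ℕ) {ε : ℝ}
    (hε : 0 < ε) (Z : Set (X 0)) :
    ∃ E : Finset (X 0), IsSeparated T n ε Z E ∧ IsSpanning T n ε Z E := by
  classical
  obtain ⟨t, ht⟩ := (isCompact_univ (X := X 0)).elim_finite_subcover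
    (fun x => bowenBall T n x (ε / 2)) (fun x => isOpen_bowenBall hT n x _)
    (fun x _ => Set.mem_iUnion.mpr ⟨x, by
      show bowenDist T n x x < ε / 2
      rw [bowenDist_self]; linarith⟩)
  have hx : ∀ x, ∃ c ∈ t, bowenDist T n c x < ε / 2 := fun x => by
    simpa [bowenBall] using ht (Set.mem_univ x)
  choose c hct hc using hx
  have hcard : ∀ E : Finset (X 0), IsSeparated T n ε Z E → E.card ≤ t.card := by
    intro E hE
    refine Finset.card_le_card_of_injOn c (fun x _ => hct x) ?_
    intro x hxE y hyE hxy
    by_contra hne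
    have h1 := hE.2 x hxE y hyE hne
    have h2 := bowenDist_triangle T n x (c x) y
    rw [bowenDist_comm T n x (c x)] at h2
    have h3 := hc x
    have h4 := hc y
    rw [← hxy] at h4
    linarith
  let S : Set ℕ := {k | ∃ E : Finset (X 0), IsSeparated T n ε Z E ∧ E.card = k}
  have hne : S.Nonempty := ⟨0, ∅, ⟨by simp, by simp⟩, by simp⟩
  have hbdd : BddAbove S := ⟨t.card, by rintro k ⟨E, hE, rfl⟩; exact hcard E hE⟩
  obtain ⟨E, hE, hEc⟩ := Nat.sSup_mem hne hbdd
  refine ⟨E, hE, fun x hxZ => ?_⟩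
  by_contra hcon
  push Not at hcon
  have hxE : x ∉ E := fun h => by
    have := hcon x h
    rw [bowenDist_self] at this; linarith
  have hsep : IsSeparated T n ε Z (insert x E) := by
    refine ⟨?_, ?_⟩
    · rw [Finset.coe_insert]; exact Set.insert_subset hxZ hE.1
    · intro a ha b hb hab
      rcases Finset.mem_insert.mp ha with rfl | ha'
      · rcases Finset.mem_insert.mp hb with rfl | hb
        · exact absurd rfl hab
        · exact hcon b hb
      · rcases Finset.mem_insert.mp hb with rfl | hb
        · rw [bowenDist_comm]; exact hcon a ha'
        · exact hE.2 a ha' b hb hab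
  have h1 : (insert x E).card ≤ sSup S := le_csSup hbdd ⟨_, hsep, rfl⟩
  rw [Finset.card_insert_of_notMem hxE, hEc] at h1
  omega

variable (f : ∀ k, X k → ℝ)

theorem weight_split (s : ℝ) (n : ℕ) (x : X 0) :
    ENNReal.ofReal (Real.exp (-(n : ℝ) * s + birk T f n x)) =
      ENNReal.ofReal (Real.exp (-(n : ℝ) * s)) * ENNReal.ofReal (Real.exp (birk T f n x)) := by
  rw [Real.exp_add, ENNReal.ofReal_mul (Real.exp_pos _).le]

theorem ballSum_slice (s : ℝ) (n : ℕ) (F : Finset (X 0)) :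
    ballSum T f s ((fun x => (x, n)) '' (F : Set (X 0))) =
      ENNReal.ofReal (Real.exp (-(n : ℝ) * s)) * partSum T f n F := by
  unfold ballSum partSum
  rw [tsum_image (fun p : X 0 × ℕ =>
    ENNReal.ofReal (Real.exp (-(p.2 : ℝ) * s + birk T f p.2 p.1)))
    (fun x _ y _ h => (Prod.mk.inj h).1)]
  rw [Finset.mul_sum, ← Finset.tsum_subtype]
  simp only [weight_split]
  rfl

theorem preMeas_mono (Z : Set (X 0)) (s ε : ℝ) {N M : ℕ} (h : N ≤ M) :
    bowenPreMeas T f Z s N ε ≤ bowenPreMeas T f Z s M ε := by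
  refine le_iInf₂ fun C hC => iInf₂_le C ⟨hC.1, fun p hp => h.trans (hC.2.1 p hp), hC.2.2⟩

theorem cover_slice {n : ℕ} {ε δ : ℝ} (h : ε < δ) {Z : Set (X 0)} {F : Finset (X 0)}
    (hF : IsSpanning T n ε Z F) :
    IsBowenCover T n δ Z ((fun x => (x, n)) '' (F : Set (X 0))) := by
  refine ⟨(F.countable_toSet).image _, ?_, ?_⟩
  · rintro p ⟨x, _, rfl⟩; exact le_rfl
  · intro x hx
    obtain ⟨y, hy, hxy⟩ := hF x hx
    simp only [Set.mem_iUnion]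
    refine ⟨(y, n), ⟨y, hy, rfl⟩, ?_⟩
    show bowenDist T n y x < δ
    rw [bowenDist_comm]; linarith

theorem PBe_le_lowRate (Z : Set (X 0)) {ε : ℝ} (hε : 0 < ε) :
    PBe T f Z ε ≤ lowRate fun n => Qn T f Z n (ε / 2) := by
  refine crit_le fun s s' h1 h2 => ?_
  have hfreq := Filter.frequently_lt_of_liminf_lt (by isBoundedDefault) h1
  have hr := ENNReal.tendsto_pow_atTop_nhds_zero_of_lt_one (r_lt_one h2)
  refine le_antisymm (iSup_le fun N => ?_) bot_le
  refine le_of_forall_gt fun η hη => ?_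
  obtain ⟨n, hn1, hn2, hn3, hn4⟩ := (hfreq.and_eventually
    ((Filter.eventually_gt_atTop 0).and ((Filter.eventually_ge_atTop N).and
      (hr.eventually_lt_const hη)))).exists
  have hQ := rate_lt hn2 hn1
  simp only [Qn, iInf_lt_iff] at hQ
  obtain ⟨F, hF, hFs⟩ := hQ
  calc bowenPreMeas T f Z s N ε ≤ bowenPreMeas T f Z s n ε := preMeas_mono T f Z s ε hn3
    _ ≤ ballSum T f s ((fun x => (x, n)) '' (F : Set (X 0))) :=
      iInf₂_le _ (cover_slice T (by linarith) hF)
    _ = ENNReal.ofReal (Real.exp (-(n : ℝ) * s)) * partSum T f n F := ballSum_slice T f s n F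
    _ ≤ ENNReal.ofReal (Real.exp (-(n : ℝ) * s)) * ENNReal.ofReal (Real.exp (n * s')) := by
      gcongr
    _ = _ := exp_pow s s' n
    _ < η := hn4

variable {T} in
theorem Qn_le_Pn [CompactSpace (X 0)] (hT : ∀ k, Continuous (T k)) (Z : Set (X 0)) (n : ℕ)
    {ε : ℝ} (hε : 0 < ε) : Qn T f Z n ε ≤ Pn T f Z n ε := by
  obtain ⟨E, h1, h2⟩ := exists_sep_span hT n hε Z
  exact (iInf₂_le E h2).trans (le_iSup₂ (f := fun (E : Finset (X 0))
    (_ : IsSeparated T n ε Z E) => partSum T f n E) E h1)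

variable {T} in
theorem preMeas_le_packPre [CompactSpace (X 0)] (hT : ∀ k, Continuous (T k)) (Z : Set (X 0))
    (s : ℝ) (N : ℕ) {ε : ℝ} (hε : 0 < ε) :
    bowenPreMeas T f Z s N (3 * ε) ≤ packPre T f Z s N ε := by
  obtain ⟨E, h1, h2⟩ := exists_sep_span hT N (ε := 2 * ε) (by linarith) Z
  have hp : IsBowenPacking T N ε Z ((fun x => (x, N)) '' (E : Set (X 0))) := by
    refine ⟨(E.countable_toSet).image _, ?_, ?_⟩
    · rintro p ⟨x, hx, rfl⟩; exact ⟨h1.1 hx, le_rfl⟩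
    · rintro p ⟨x, hx, rfl⟩ q ⟨y, hy, rfl⟩ hne
      have hxy : x ≠ y := fun h => hne (by rw [h])
      rw [Set.disjoint_left]
      intro z hz1 hz2
      have a1 : bowenDist T N x z ≤ ε := hz1
      have a2 : bowenDist T N y z ≤ ε := hz2
      have a3 := h1.2 x hx y hy hxy
      have a4 := bowenDist_triangle T N x z y
      rw [bowenDist_comm T N z y] at a4
      linarith
  exact (iInf₂_le _ (cover_slice T (by linarith) h2)).trans
    (le_iSup₂ (f := fun (P : Set (X 0 × ℕ)) (_ : IsBowenPacking T N ε Z P) =>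
      ballSum T f s P) _ hp)

theorem packPre_anti (Z : Set (X 0)) (s ε : ℝ) {N M : ℕ} (h : N ≤ M) :
    packPre T f Z s M ε ≤ packPre T f Z s N ε := by
  refine iSup₂_le fun P hP => ?_
  exact le_iSup₂ (f := fun (P : Set (X 0 × ℕ)) (_ : IsBowenPacking T N ε Z P) =>
      ballSum T f s P) P ⟨hP.1, fun p hp => ⟨(hP.2.1 p hp).1, h.trans (hP.2.1 p hp).2⟩, hP.2.2⟩

variable {T} in
theorem preMeas_le_packContent [CompactSpace (X 0)] (hT : ∀ k, Continuous (T k)) (Z : Set (X 0))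
    (s : ℝ) (N : ℕ) {ε : ℝ} (hε : 0 < ε) :
    bowenPreMeas T f Z s N (3 * ε) ≤ packContent T f Z s ε := by
  refine le_iInf fun M => ?_
  calc _ ≤ bowenPreMeas T f Z s (max N M) (3 * ε) := preMeas_mono T f Z s _ (le_max_left _ _)
    _ ≤ packPre T f Z s (max N M) ε := preMeas_le_packPre f hT Z s _ hε
    _ ≤ _ := packPre_anti T f Z s ε (le_max_right _ _)

theorem preMeas_subadd {Z : Set (X 0)} (D : ℕ → Set (X 0)) (hD : Z ⊆ ⋃ i, D i) (s : ℝ) (N : ℕ)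
    (ε : ℝ) : bowenPreMeas T f Z s N ε ≤ ∑' i, bowenPreMeas T f (D i) s N ε := by
  refine ENNReal.le_of_forall_pos_le_add fun η hη hfin => ?_
  obtain ⟨e, he, hes⟩ := ENNReal.exists_pos_sum_of_countable'
    (ENNReal.coe_ne_zero.mpr hη.ne') ℕ
  have hi : ∀ i, ∃ C, IsBowenCover T N ε (D i) C ∧
      ballSum T f s C < bowenPreMeas T f (D i) s N ε + e i := by
    intro i
    have hlt : bowenPreMeas T f (D i) s N ε < bowenPreMeas T f (D i) s N ε + e i :=
      ENNReal.lt_add_right (ENNReal.ne_top_of_tsum_ne_top hfin.ne i) (he i).ne'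
    conv_lhs at hlt => unfold bowenPreMeas
    simp only [iInf_lt_iff] at hlt
    obtain ⟨C, hC, h⟩ := hlt
    exact ⟨C, hC, h⟩
  choose C hC hCs using hi
  have hcov : IsBowenCover T N ε Z (⋃ i, C i) := by
    refine ⟨Set.countable_iUnion fun i => (hC i).1, ?_, ?_⟩
    · intro p hp
      obtain ⟨i, hi⟩ := Set.mem_iUnion.mp hp
      exact (hC i).2.1 p hi
    · intro x hx
      obtain ⟨i, hi⟩ := Set.mem_iUnion.mp (hD hx)
      have := (hC i).2.2 hi
      simp only [Set.mem_iUnion] at this ⊢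
      obtain ⟨p, hp, hxp⟩ := this
      exact ⟨p, ⟨i, hp⟩, hxp⟩
  calc bowenPreMeas T f Z s N ε ≤ ballSum T f s (⋃ i, C i) := iInf₂_le _ hcov
    _ ≤ ∑' i, ballSum T f s (C i) :=
      ENNReal.tsum_iUnion_le_tsum (fun p : X 0 × ℕ =>
        ENNReal.ofReal (Real.exp (-(p.2 : ℝ) * s + birk T f p.2 p.1))) C
    _ ≤ ∑' i, (bowenPreMeas T f (D i) s N ε + e i) := ENNReal.tsum_le_tsum fun i => (hCs i).le
    _ = ∑' i, bowenPreMeas T f (D i) s N ε + ∑' i, e i := ENNReal.tsum_add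
    _ ≤ _ := by gcongr

variable {T} in
theorem PBe_le_PPe [CompactSpace (X 0)] (hT : ∀ k, Continuous (T k)) (Z : Set (X 0))
    {ε : ℝ} (hε : 0 < ε) : PBe T f Z (3 * ε) ≤ PPe T f Z ε := by
  refine crit_mono fun s => iSup_le fun N => le_iInf₂ fun D hD => ?_
  exact (preMeas_subadd T f D hD s N _).trans
    (ENNReal.tsum_le_tsum fun i => preMeas_le_packContent f hT (D i) s N hε)

theorem tail_le (r : ℝ≥0∞) (N : ℕ) :
    ∑' n, (if N ≤ n then r ^ n else 0) ≤ ∑' k, r ^ (k + N) := by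
  rw [← ENNReal.summable.sum_add_tsum_nat_add' (f := fun n => if N ≤ n then r ^ n else 0) (k := N)]
  have h0 : ∑ i ∈ Finset.range N, (if N ≤ i then r ^ i else 0) = 0 :=
    Finset.sum_eq_zero fun i hi => if_neg (not_le.mpr (Finset.mem_range.mp hi))
  rw [h0, zero_add]
  refine ENNReal.tsum_le_tsum fun k => ?_
  rw [if_pos (Nat.le_add_left N k)]

theorem ballSum_packing_le {Z : Set (X 0)} {s s' ε : ℝ} {N : ℕ} (hε : 0 < ε)
    (hN : ∀ n, N ≤ n → Pn T f Z n ε ≤ ENNReal.ofReal (Real.exp (n * s')))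
    {P : Set (X 0 × ℕ)} (hP : IsBowenPacking T N ε Z P) :
    ballSum T f s P ≤ ∑' k, (ENNReal.ofReal (Real.exp (s' - s))) ^ (k + N) := by
  classical
  set r := ENNReal.ofReal (Real.exp (s' - s)) with hr
  let g : X 0 × ℕ → ℝ≥0∞ := fun p =>
    ENNReal.ofReal (Real.exp (-(p.2 : ℝ) * s + birk T f p.2 p.1))
  have h1 : ballSum T f s P = ∑' n, ∑' x, P.indicator g (x, n) := by
    calc ballSum T f s P = ∑' p, P.indicator g p := tsum_subtype P g
      _ = ∑' x, ∑' n, P.indicator g (x, n) := ENNReal.tsum_prod' 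
      _ = _ := ENNReal.tsum_comm
  have h2 : ∀ n, ∑' x, P.indicator g (x, n) ≤ if N ≤ n then r ^ n else 0 := by
    intro n
    split_ifs with hn
    · rw [ENNReal.tsum_eq_iSup_sum]
      refine iSup_le fun S => ?_
      have hsep : IsSeparated T n ε Z (S.filter fun x => (x, n) ∈ P) := by
        refine ⟨?_, ?_⟩
        · intro x hx
          exact (hP.2.1 (x, n) (Finset.mem_filter.mp hx).2).1
        · intro x hx y hy hxy
          have hd := hP.2.2 (x, n) (Finset.mem_filter.mp hx).2 (y, n)
            (Finset.mem_filter.mp hy).2 (fun h => hxy (Prod.mk.inj h).1)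
          by_contra hcon
          push Not at hcon
          refine Set.disjoint_left.mp hd (show y ∈ bowenClosedBall T n x ε from hcon) ?_
          show bowenDist T n y y ≤ ε
          rw [bowenDist_self]; exact hε.le
      calc ∑ x ∈ S, P.indicator g (x, n)
          = ∑ x ∈ S.filter (fun x => (x, n) ∈ P), g (x, n) := by
            rw [Finset.sum_filter]
            exact Finset.sum_congr rfl fun x _ => by rw [Set.indicator_apply]
        _ = ENNReal.ofReal (Real.exp (-(n : ℝ) * s)) *
              partSum T f n (S.filter (fun x => (x, n) ∈ P)) := by
            unfold partSum
            rw [Finset.mul_sum]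
            exact Finset.sum_congr rfl fun x _ => weight_split T f s n x
        _ ≤ ENNReal.ofReal (Real.exp (-(n : ℝ) * s)) * ENNReal.ofReal (Real.exp (n * s')) := by
            gcongr
            exact (le_iSup₂ (f := fun (E : Finset (X 0))
              (_ : IsSeparated T n ε Z E) => partSum T f n E) _ hsep).trans (hN n hn)
        _ = r ^ n := exp_pow s s' n
    · refine le_of_eq (ENNReal.tsum_eq_zero.mpr fun x => Set.indicator_of_notMem ?_ _)
      exact fun h => hn (hP.2.1 _ h).2
  rw [h1]
  refine (ENNReal.tsum_le_tsum h2).trans ?_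
  exact tail_le r N

theorem PPe_le_upRate (Z : Set (X 0)) {ε : ℝ} (hε : 0 < ε) :
    PPe T f Z ε ≤ upRate fun n => Pn T f Z n ε := by
  refine crit_le fun s s' h1 h2 => ?_
  have hev := (Filter.eventually_lt_of_limsup_lt h1).and (Filter.eventually_gt_atTop 0)
  obtain ⟨N₀, hN₀⟩ := Filter.eventually_atTop.mp hev
  have hr1 := r_lt_one h2
  have hsum : ∑' k : ℕ, (ENNReal.ofReal (Real.exp (s' - s))) ^ k ≠ ⊤ := by
    rw [ENNReal.tsum_geometric]
    exact ENNReal.inv_ne_top.mpr (tsub_pos_of_lt hr1).ne'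
  have htail := ENNReal.tendsto_sum_nat_add _ hsum
  have hcont : packContent T f Z s ε = 0 := by
    refine le_antisymm (ge_of_tendsto htail ?_) bot_le
    filter_upwards [Filter.eventually_ge_atTop N₀] with N hN
    refine (iInf_le _ N).trans (iSup₂_le fun P hP => ?_)
    refine ballSum_packing_le T f hε (fun n hn => ?_) hP
    have := hN₀ n (hN.trans hn)
    exact (rate_lt this.2 this.1).le
  refine le_antisymm ((iInf₂_le (fun _ => Z) (Set.subset_iUnion (fun _ : ℕ => Z) 0)).trans ?_)
    bot_le
  simp [hcont]

end helpers

end NDS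

/-- The pressure inequalities
`P^B ≤ Q_low ≤ Q_up`, `P^B ≤ P_low ≤ P_up` and `P^B ≤ P^P ≤ P_up`. -/
theorem pressure_inequalities {X : ℕ → Type*} [∀ k, MetricSpace (X k)]
    [∀ k, CompactSpace (X k)] (T : ∀ k, X k → X (k + 1)) (hT : ∀ k, Continuous (T k))
    (f : ∀ k, X k → ℝ) (hf : ∀ k, Continuous (f k)) (Z : Set (X 0)) :
    (NDS.PB T f Z ≤ NDS.Qlow T f Z ∧ NDS.Qlow T f Z ≤ NDS.Qup T f Z) ∧
    (NDS.PB T f Z ≤ NDS.Plow T f Z ∧ NDS.Plow T f Z ≤ NDS.Pup T f Z) ∧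
    (NDS.PB T f Z ≤ NDS.PP T f Z ∧ NDS.PP T f Z ≤ NDS.Pup T f Z) := by
  have hQ : NDS.PB T f Z ≤ NDS.Qlow T f Z := by
    refine iSup₂_le fun ε hε => (NDS.PBe_le_lowRate T f Z hε).trans ?_
    exact le_iSup₂ (f := fun (ε : ℝ) (_ : 0 < ε) => NDS.lowRate fun n => NDS.Qn T f Z n ε)
      (ε / 2) (by linarith)
  refine ⟨⟨hQ, ?_⟩, ⟨hQ.trans ?_, ?_⟩, ?_, ?_⟩
  · exact iSup₂_mono fun ε _ => NDS.lowRate_le_upRate _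
  · exact iSup₂_mono fun ε hε => NDS.lowRate_mono fun n => NDS.Qn_le_Pn f hT Z n hε
  · exact iSup₂_mono fun ε _ => NDS.lowRate_le_upRate _
  · refine iSup₂_le fun ε hε => ?_
    have h := NDS.PBe_le_PPe f hT Z (ε := ε / 3) (by linarith)
    rw [mul_div_cancel₀ ε (by norm_num : (3 : ℝ) ≠ 0)] at h
    exact h.trans (le_iSup₂ (f := fun (ε : ℝ) (_ : 0 < ε) => NDS.PPe T f Z ε)
      (ε / 3) (by linarith))
  · exact iSup₂_mono fun ε hε => NDS.PPe_le_upRate T f Z hε
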